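/- arXiv:math/0309224 — 4 statements merged into one kernel-verified Lean document; each statement's English description precedes it below -/
import Mathlib

section
/- The number of positive integers n ≤ X such that the interval [n, n+1) contains a Z-number is at most X^θ for all sufficiently large X, where θ = log₂(3/2). -/
open scoped Classical

/-- A real number `ξ > 0` is a Z-number if `0 ≤ {ξ·(3/2)^k} < 1/2` for every integer `k ≥ 0`. -/
def IsZNumber (ξ : ℝ) : Prop :=
  0 < ξ ∧ ∀ k : ℕ, Int.fract (ξ * (3 / 2 : ℝ) ^ k) < 1 / 2

/-- `A n c` is a sum over the admissible parity words of length `n` started in state `c`: a word may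
begin with either parity when `2/3 < c`, the odd ones being weighted by `ζ`, and is forced to begin
with an even one otherwise. -/
structure IsTwistedCount (ζ : ℕ → ℂ) (A : ℕ → ℝ → ℂ) : Prop where
  norm_twist : ∀ n, ‖ζ n‖ ≤ 1
  norm_zero : ∀ c, ‖A 0 c‖ ≤ 1
  branch : ∀ n c, 2 / 3 < c → A (n + 1) c = A n 1 + ζ n * A n (3 / 2 * c - 1)
  forced : ∀ n c, c ≤ 2 / 3 → A (n + 1) c = A n (3 / 2 * c)

namespace IsTwistedCount

variable {ζ : ℕ → ℂ} {A : ℕ → ℝ → ℂ}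

theorem norm_branch_le (h : IsTwistedCount ζ A) (n : ℕ) {c : ℝ} (hc : 2 / 3 < c) :
    ‖A (n + 1) c‖ ≤ ‖A n 1‖ + ‖A n (3 / 2 * c - 1)‖ := by
  rw [h.branch n c hc]
  refine (norm_add_le _ _).trans ?_
  rw [norm_mul]
  have := mul_le_mul_of_nonneg_right (h.norm_twist n) (norm_nonneg (A n (3 / 2 * c - 1)))
  linarith

theorem norm_le_of_affine (h : IsTwistedCount ζ A) {m : ℕ} {p q : ℝ} (hq : 0 ≤ q)
    (hm : ∀ c, 0 < c → c ≤ 1 → ‖A m c‖ ≤ p * c + q) (l : ℕ) :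
    ∀ c, 0 < c → c ≤ 1 →
      ‖A (m + l) c‖ ≤ p * c * (3 / 2) ^ l + q * (1 + 3 * c * ((3 / 2) ^ l - 1)) := by
  induction l with
  | zero => intro c h0 h1; simpa using hm c h0 h1
  | succ l ih =>
    intro c h0 h1
    rw [← add_assoc, pow_succ]
    rcases lt_or_ge (2 / 3) c with hc | hc
    · have h2 := h.norm_branch_le (m + l) hc
      have h3 := ih 1 one_pos le_rfl
      have h4 := ih (3 / 2 * c - 1) (by linarith) (by linarith)
      have h5 := mul_nonneg hq (by linarith : (0 : ℝ) ≤ 3 / 2 * c - 1)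
      linear_combination h2 + h3 + h4 + h5
    · rw [h.forced _ _ hc]
      have h4 := ih (3 / 2 * c) (by linarith) (by linarith)
      have h5 := mul_nonneg hq h0.le
      linear_combination h4 + 3 / 2 * h5

theorem norm_le (h : IsTwistedCount ζ A) (n : ℕ) {c : ℝ} (h0 : 0 < c) (h1 : c ≤ 1) :
    ‖A n c‖ ≤ 3 * (3 / 2) ^ n := by
  have h2 := h.norm_le_of_affine (m := 0) (p := 0) zero_le_one
    (fun c _ _ => by simpa using h.norm_zero c) n c h0 h1
  rw [zero_add] at h2
  have h3 : (1 : ℝ) ≤ (3 / 2) ^ n := one_le_pow₀ (by norm_num)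
  nlinarith

theorem norm_le_of_norm_one_le (h : IsTwistedCount ζ A) {m : ℕ} {s : ℝ} (hs : 0 ≤ s)
    (hm : ∀ n, m ≤ n → ‖A n 1‖ ≤ s * (3 / 2) ^ n) {n : ℕ} (hn : m ≤ n) :
    ∀ c, 0 < c → c ≤ 1 → ‖A n c‖ ≤ s * c * (3 / 2) ^ n + 3 * (3 / 2) ^ m := by
  induction n, hn using Nat.le_induction with
  | base =>
    intro c h0 h1
    have := h.norm_le m h0 h1
    have : 0 ≤ s * c * (3 / 2) ^ m := by positivity
    linarith
  | succ n hn ih =>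
    intro c h0 h1
    rw [pow_succ]
    rcases lt_or_ge (2 / 3) c with hc | hc
    · have h2 := h.norm_branch_le n hc
      have h4 := ih (3 / 2 * c - 1) (by linarith) (by linarith)
      linear_combination h2 + hm n hn + h4
    · rw [h.forced _ _ hc]
      have h4 := ih (3 / 2 * c) (by linarith) (by linarith)
      linear_combination h4

/-- A twist away from `1` forces cancellation between the words beginning with `000` and `100`. -/
theorem norm_one_le_of_twist (h : IsTwistedCount ζ A) {m : ℕ} {s : ℝ} (hs : 0 ≤ s)
    (hm : ∀ n, m ≤ n → ‖A n 1‖ ≤ s * (3 / 2) ^ n) {n : ℕ} (hn : m ≤ n)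
    (hζ : ‖1 + ζ (n + 2)‖ ≤ 7 / 4) :
    ‖A (n + 3) 1‖ ≤ 25 / 27 * s * (3 / 2) ^ (n + 3) + 9 * (3 / 2) ^ m := by
  have e1 : A (n + 3) 1 = (1 + ζ (n + 2)) * A n 1 + ζ n * A n (1 / 2)
      + ζ (n + 1) * A (n + 1) (1 / 2) + ζ (n + 2) * ζ n * A n (1 / 8) := by
    have a1 := h.branch (n + 2) 1 (by norm_num)
    have a2 := h.branch (n + 1) 1 (by norm_num)
    have a3 := h.branch n 1 (by norm_num)
    have a4 := h.forced (n + 1) (1 / 2) (by norm_num)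
    have a5 := h.branch n (3 / 4) (by norm_num)
    norm_num [add_assoc] at a1 a2 a3 a4 a5 ⊢
    rw [a1, a2, a3, a4, a5]
    ring
  have b1 := hm n hn
  have b2 := h.norm_le_of_norm_one_le hs hm hn (1 / 2) (by norm_num) (by norm_num)
  have b3 := h.norm_le_of_norm_one_le hs hm (hn.trans n.le_succ) (1 / 2) (by norm_num)
    (by norm_num)
  have b4 := h.norm_le_of_norm_one_le hs hm hn (1 / 8) (by norm_num) (by norm_num)
  have c1 : ‖(1 + ζ (n + 2)) * A n 1‖ ≤ 7 / 4 * (s * (3 / 2) ^ n) := by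
    rw [norm_mul]; gcongr
  have twist_le : ∀ z a : ℂ, ‖z‖ ≤ 1 → ‖z * a‖ ≤ ‖a‖ := fun z a hz => by
    rw [norm_mul]; exact mul_le_of_le_one_left (norm_nonneg _) hz
  have c2 := twist_le _ (A n (1 / 2)) (h.norm_twist n)
  have c3 := twist_le _ (A (n + 1) (1 / 2)) (h.norm_twist (n + 1))
  have c4 := twist_le (ζ (n + 2) * ζ n) (A n (1 / 8))
    ((twist_le _ _ (h.norm_twist _)).trans (h.norm_twist _))
  have d := norm_add₄_le (a := (1 + ζ (n + 2)) * A n 1) (b := ζ n * A n (1 / 2))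
    (c := ζ (n + 1) * A (n + 1) (1 / 2)) (d := ζ (n + 2) * ζ n * A n (1 / 8))
  rw [← e1] at d
  rw [pow_succ] at b3
  rw [pow_add]
  norm_num at b3 ⊢
  linarith

theorem norm_le_of_gain (h : IsTwistedCount ζ A) {m : ℕ} {s δ E : ℝ} (hs : 0 ≤ s)
    (hm : ∀ n, m ≤ n → ‖A n 1‖ ≤ s * (3 / 2) ^ n) {n : ℕ} (hn : m ≤ n)
    (hgain : ‖A n 1‖ ≤ s * (1 - δ) * (3 / 2) ^ n + E) (l : ℕ) :
    ∀ c, (2 / 3) ^ l ≤ c → c ≤ 1 → ‖A (n + l) c‖ ≤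
      s * (c - (2 / 3) ^ l * δ) * (3 / 2) ^ (n + l) + (E + l * (3 * (3 / 2) ^ m)) := by
  induction l with
  | zero =>
    intro c h0 h1
    obtain rfl : c = 1 := le_antisymm h1 (by simpa using h0)
    simpa using hgain
  | succ l ih =>
    intro c h0 h1
    have hpos : (0 : ℝ) < (2 / 3) ^ l := by positivity
    have hle : (2 / 3 : ℝ) ^ l ≤ 1 := pow_le_one₀ (by norm_num) (by norm_num)
    have hnl : m ≤ n + l := by omega
    rw [← add_assoc, pow_succ, pow_succ (3 / 2 : ℝ)]
    rw [pow_succ] at h0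
    push_cast
    rcases lt_or_ge (2 / 3) c with hc | hc
    · have h2 := h.norm_branch_le (n + l) hc
      have h3 := ih 1 hle le_rfl
      have h4 := h.norm_le_of_norm_one_le hs hm hnl (3 / 2 * c - 1) (by linarith) (by linarith)
      linear_combination h2 + h3 + h4
    · rw [h.forced _ _ hc]
      have h4 := ih (3 / 2 * c) (by linarith) (by linarith)
      have : (0 : ℝ) ≤ 3 * (3 / 2) ^ m := by positivity
      linear_combination h4 + this

theorem norm_one_le_of_gain (h : IsTwistedCount ζ A) {m : ℕ} {s : ℝ} (hs : 0 ≤ s)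
    (hm : ∀ n, m ≤ n → ‖A n 1‖ ≤ s * (3 / 2) ^ n) {k : ℕ} (hk : m ≤ k)
    (hζ : ‖1 + ζ (k + 2)‖ ≤ 7 / 4) {n : ℕ} (hn : k + 8 ≤ n) :
    ‖A n 1‖ ≤ (s * (1 - 32 / 6561) + 72 * (2 / 3) ^ (k - m)) * (3 / 2) ^ n := by
  have hk3 : m ≤ k + 3 := by omega
  have hgain : ‖A (k + 3) 1‖ ≤ s * (1 - 2 / 27) * (3 / 2) ^ (k + 3) + 9 * (3 / 2) ^ m := by
    refine (h.norm_one_le_of_twist hs hm hk hζ).trans (le_of_eq ?_)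
    ring
  have h5 := h.norm_le_of_gain hs hm hk3 hgain 5
  have hE : (0 : ℝ) < (3 / 2) ^ m := by positivity
  have hB : (0 : ℝ) < (3 / 2) ^ (k + 8) := by positivity
  have hsB : 0 ≤ s * (3 / 2) ^ (k + 8) := mul_nonneg hs hB.le
  have h6 : ∀ c, 0 < c → c ≤ 1 → ‖A (k + 8) c‖ ≤ s * (3 / 2) ^ (k + 8) * (1 - 64 / 6561) * c +
      (s * (3 / 2) ^ (k + 8) * (64 / 6561 * (32 / 243)) + 24 * (3 / 2) ^ m) := by
    intro c h0 h1
    rcases le_total ((2 / 3 : ℝ) ^ 5) c with hc | hc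
    · have := h5 c hc h1
      norm_num only [add_assoc] at this hc ⊢
      nlinarith
    · have := h.norm_le_of_norm_one_le hs hm (show m ≤ k + 8 by omega) c h0 h1
      norm_num only at this hc ⊢
      nlinarith
  obtain ⟨l, rfl⟩ := Nat.exists_eq_add_of_le hn
  have h7 := h.norm_le_of_affine (by positivity) h6 l 1 one_pos le_rfl
  have hE' : (3 / 2 : ℝ) ^ m = (2 / 3) ^ (k - m) * (3 / 2) ^ k := by
    obtain ⟨j, rfl⟩ := Nat.exists_eq_add_of_le hk
    rw [Nat.add_sub_cancel_left, pow_add, mul_comm, mul_assoc, ← mul_pow]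
    norm_num
  have hl : (0 : ℝ) < (3 / 2) ^ l := by positivity
  have hkk : (0 : ℝ) < (3 / 2) ^ k := by positivity
  have hj : (0 : ℝ) < (2 / 3) ^ (k - m) := by positivity
  refine h7.trans ?_
  rw [hE', pow_add (3 / 2 : ℝ) (k + 8) l, pow_add (3 / 2 : ℝ) k 8]
  have p1 : 0 ≤ s * (3 / 2) ^ k * (3 / 2) ^ l := by positivity
  have p2 : 0 ≤ (2 / 3 : ℝ) ^ (k - m) * (3 / 2) ^ k * (3 / 2) ^ l := by positivity
  have p3 : 0 ≤ s * (3 / 2) ^ k := by positivity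
  have p4 : 0 ≤ (2 / 3 : ℝ) ^ (k - m) * (3 / 2) ^ k := by positivity
  norm_num only
  linarith

/-- Twists away from `1` in a sequence of bounded windows make the sums negligible, at a rate
depending only on the windows. -/
theorem exists_norm_one_le {ι : Type*} {ζ : ι → ℕ → ℂ} {A : ι → ℕ → ℝ → ℂ}
    (h : ∀ i, IsTwistedCount (ζ i) (A i))
    (hζ : ∀ k, ∃ K, ∀ i, ∃ n, k ≤ n ∧ n ≤ K ∧ ‖1 + ζ i n‖ ≤ 7 / 4) {ε : ℝ} (hε : 0 < ε) :
    ∃ n₀, ∀ i n, n₀ ≤ n → ‖A i n 1‖ ≤ ε * (3 / 2) ^ n := by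
  have key : ∀ r : ℕ, ∃ n₀, ∀ i n, n₀ ≤ n →
      ‖A i n 1‖ ≤ 3 * (1 - 16 / 6561) ^ r * (3 / 2) ^ n := by
    intro r
    induction r with
    | zero => exact ⟨0, fun i n _ => by simpa using (h i).norm_le n one_pos le_rfl⟩
    | succ r ih =>
      obtain ⟨m, hm⟩ := ih
      have hs : (0 : ℝ) < 3 * (1 - 16 / 6561) ^ r := by positivity
      obtain ⟨L, hL⟩ := exists_pow_lt_of_lt_one
        (show (0 : ℝ) < 3 * (1 - 16 / 6561) ^ r * (16 / 6561) / 72 by positivity)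
        (show (2 / 3 : ℝ) < 1 by norm_num)
      obtain ⟨K, hK⟩ := hζ (m + L + 2)
      refine ⟨K + 8, fun i n hn => ?_⟩
      obtain ⟨k, hk, hkK, hk'⟩ := hK i
      obtain ⟨k, rfl⟩ := Nat.exists_eq_add_of_le' (show 2 ≤ k by omega)
      refine ((h i).norm_one_le_of_gain hs.le (hm i) (show m ≤ k by omega) hk'
        (show k + 8 ≤ n by omega)).trans ?_
      have : (2 / 3 : ℝ) ^ (k - m) ≤ (2 / 3) ^ L :=
        pow_le_pow_of_le_one (by norm_num) (by norm_num) (by omega)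
      gcongr
      rw [pow_succ]
      linarith
  obtain ⟨r, hr⟩ := exists_pow_lt_of_lt_one (show 0 < ε / 3 by positivity)
    (show (1 - 16 / 6561 : ℝ) < 1 by norm_num)
  obtain ⟨n₀, h₀⟩ := key r
  refine ⟨n₀, fun i n hn => (h₀ i n hn).trans ?_⟩
  gcongr
  linarith

end IsTwistedCount

/-- `IsAdmissible n c g`: the first `n` parities of the orbit of `g` under `2a ↦ 3a`,
`2a + 1 ↦ 3a + 2` begin an expansion in base `3/2` of some number smaller than `c`. -/
def IsAdmissible : ℕ → ℝ → ℕ → Prop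
  | 0, _, _ => True
  | n + 1, c, g =>
    if 2 / 3 < c then
      if g % 2 = 0 then IsAdmissible n 1 (3 * (g / 2))
      else IsAdmissible n (3 / 2 * c - 1) (3 * (g / 2) + 2)
    else g % 2 = 0 ∧ IsAdmissible n (3 / 2 * c) (3 * (g / 2))

theorem isAdmissible_succ_even (n : ℕ) (c : ℝ) (a : ℕ) :
    IsAdmissible (n + 1) c (2 * a) ↔
      IsAdmissible n (if 2 / 3 < c then 1 else 3 / 2 * c) (3 * a) := by
  have h1 : 2 * a % 2 = 0 := by omega
  have h2 : 2 * a / 2 = a := by omega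
  simp only [IsAdmissible, h1, h2]
  split_ifs <;> simp

theorem isAdmissible_succ_odd (n : ℕ) (c : ℝ) (a : ℕ) :
    IsAdmissible (n + 1) c (2 * a + 1) ↔
      2 / 3 < c ∧ IsAdmissible n (3 / 2 * c - 1) (3 * a + 2) := by
  have h1 : (2 * a + 1) % 2 = 1 := by omega
  have h2 : (2 * a + 1) / 2 = a := by omega
  simp only [IsAdmissible, h1, h2]
  split_ifs <;> simp_all

theorem isAdmissible_add_two_pow_mul (n : ℕ) :
    ∀ (c : ℝ) (g t : ℕ), IsAdmissible n c (g + 2 ^ n * t) ↔ IsAdmissible n c g := by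
  induction n with
  | zero => intros; simp [IsAdmissible]
  | succ n ih =>
    intro c g t
    obtain ⟨a, rfl | rfl⟩ := g.even_or_odd'
    · rw [show 2 * a + 2 ^ (n + 1) * t = 2 * (a + 2 ^ n * t) by ring, isAdmissible_succ_even,
        isAdmissible_succ_even, show 3 * (a + 2 ^ n * t) = 3 * a + 2 ^ n * (3 * t) by ring, ih]
    · rw [show 2 * a + 1 + 2 ^ (n + 1) * t = 2 * (a + 2 ^ n * t) + 1 by ring,
        isAdmissible_succ_odd, isAdmissible_succ_odd,
        show 3 * (a + 2 ^ n * t) + 2 = 3 * a + 2 + 2 ^ n * (3 * t) by ring, ih]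

theorem IsZNumber.mul_three_halves {ξ : ℝ} (h : IsZNumber ξ) : IsZNumber (3 / 2 * ξ) := by
  refine ⟨by linarith [h.1], fun k => ?_⟩
  have := h.2 (k + 1)
  rwa [pow_succ, show ξ * ((3 / 2) ^ k * (3 / 2)) = 3 / 2 * ξ * (3 / 2 : ℝ) ^ k by ring] at this

theorem IsZNumber.two_mul_sub_lt_one {ξ : ℝ} {g : ℕ} (h : IsZNumber ξ) (h1 : (g : ℝ) ≤ ξ)
    (h2 : ξ < g + 1) : 2 * (ξ - g) < 1 := by
  have h3 := h.2 0
  have h4 : ⌊ξ⌋ = g := Int.floor_eq_iff.2 ⟨by simpa using h1, by simpa using h2⟩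
  rw [pow_zero, mul_one, Int.fract, h4, Int.cast_natCast] at h3
  linarith

theorem IsZNumber.isAdmissible (n : ℕ) : ∀ {ξ c : ℝ} {g : ℕ}, IsZNumber ξ → (g : ℝ) ≤ ξ →
    ξ < g + 1 → 2 * (ξ - g) < c → IsAdmissible n c g := by
  induction n with
  | zero => intros; simp [IsAdmissible]
  | succ n ih =>
    intro ξ c g h h1 h2 h3
    have hf := h.two_mul_sub_lt_one h1 h2
    have h' := h.mul_three_halves
    obtain ⟨a, rfl | rfl⟩ := g.even_or_odd'
    · rw [isAdmissible_succ_even]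
      push_cast at *
      have hf' := h'.two_mul_sub_lt_one (g := 3 * a) (by push_cast; linarith) (by push_cast; linarith)
      refine ih h' (by push_cast; linarith) (by push_cast; linarith) ?_
      push_cast at *
      split_ifs <;> linarith
    · rw [isAdmissible_succ_odd]
      push_cast at *
      have hge : (3 * a + 2 : ℝ) ≤ 3 / 2 * ξ := by
        by_contra! hlt
        have := h'.two_mul_sub_lt_one (g := 3 * a + 1) (by push_cast; linarith) (by push_cast; linarith)
        push_cast at this
        linarith
      exact ⟨by linarith, ih h' (by push_cast; linarith) (by push_cast; linarith)
        (by push_cast; linarith)⟩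

/-- The point `exp(2πix)` of the unit circle. -/
noncomputable def unitPhase (x : ℝ) : ℂ := Complex.exp ((2 * Real.pi * x : ℝ) * Complex.I)

theorem norm_unitPhase (x : ℝ) : ‖unitPhase x‖ = 1 := Complex.norm_exp_ofReal_mul_I _

theorem unitPhase_re (x : ℝ) : (unitPhase x).re = Real.cos (2 * Real.pi * x) :=
  Complex.exp_ofReal_mul_I_re _

theorem unitPhase_im (x : ℝ) : (unitPhase x).im = Real.sin (2 * Real.pi * x) :=
  Complex.exp_ofReal_mul_I_im _

theorem unitPhase_zero : unitPhase 0 = 1 := by simp [unitPhase]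

theorem unitPhase_add (x y : ℝ) : unitPhase (x + y) = unitPhase x * unitPhase y := by
  rw [unitPhase, unitPhase, unitPhase, ← Complex.exp_add]
  push_cast
  ring_nf

theorem unitPhase_intCast (k : ℤ) : unitPhase k = 1 := by
  rw [unitPhase, ← Complex.exp_int_mul_two_pi_mul_I k]
  push_cast
  ring_nf

theorem unitPhase_add_intCast (x : ℝ) (k : ℤ) : unitPhase (x + k) = unitPhase x := by
  rw [unitPhase_add, unitPhase_intCast, mul_one]

theorem conj_unitPhase (x : ℝ) : (starRingEnd ℂ) (unitPhase x) = unitPhase (-x) := by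
  apply Complex.ext <;> simp [unitPhase_re, unitPhase_im]

theorem norm_one_add_unitPhase_le {x : ℝ} (hx : ∀ p : ℤ, 1 / 6 ≤ |x - p|) :
    ‖1 + unitPhase x‖ ≤ 7 / 4 := by
  have h1 := hx (round x)
  have h2 := abs_sub_round x
  set t := x - round x with ht
  have hcos : Real.cos (2 * Real.pi * t) ≤ 1 / 2 := by
    rw [← Real.cos_abs, ← Real.cos_pi_div_three, abs_mul,
      abs_of_pos (by positivity : 0 < 2 * Real.pi)]
    have hpi := Real.pi_pos
    apply Real.cos_le_cos_of_nonneg_of_le_pi <;> nlinarith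
  have hxt : unitPhase x = unitPhase t := by
    rw [← unitPhase_add_intCast t (round x), ht, sub_add_cancel]
  have hsq : ‖1 + unitPhase x‖ ^ 2 = 2 + 2 * Real.cos (2 * Real.pi * t) := by
    rw [hxt, Complex.sq_norm, Complex.normSq_apply]
    simp only [Complex.add_re, Complex.add_im, Complex.one_re, Complex.one_im, unitPhase_re,
      unitPhase_im]
    linear_combination Real.sin_sq_add_cos_sq (2 * Real.pi * t)
  nlinarith [norm_nonneg (1 + unitPhase x)]

theorem sub_intCast_eq_of_forall_near {x : ℝ} {L : ℕ} {p : ℕ → ℤ}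
    (hp : ∀ l ≤ L, |x * (3 / 2) ^ l - p l| < 1 / 6) {l : ℕ} (hl : l ≤ L) :
    x * (3 / 2) ^ l - p l = (x - p 0) * (3 / 2) ^ l := by
  induction l with
  | zero => simp
  | succ l ih =>
    have h1 := ih (by omega)
    have h2 := abs_lt.1 (hp l (by omega))
    have h3 := abs_lt.1 (hp (l + 1) hl)
    rw [pow_succ] at h3
    have h4 : 2 * p (l + 1) = 3 * p l := by
      have u1 : (2 * p (l + 1) : ℝ) < 3 * p l + 1 := by linarith
      have u2 : (3 * p l : ℝ) < 2 * p (l + 1) + 1 := by linarith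
      have u1' : 2 * p (l + 1) < 3 * p l + 1 := by exact_mod_cast u1
      have u2' : 3 * p l < 2 * p (l + 1) + 1 := by exact_mod_cast u2
      omega
    have h5 : (2 * p (l + 1) : ℝ) = 3 * p l := by exact_mod_cast h4
    rw [pow_succ]
    linear_combination 3 / 2 * h1 - h5 / 2

/-- Powers of `3/2` times a nonzero dyadic fraction keep leaving every small neighbourhood of the
integers, within a time controlled by the denominator. -/
theorem exists_norm_one_add_unitPhase_le (v k : ℕ) : ∃ K, ∀ w : ℤ, ¬ (2 : ℤ) ^ v ∣ w →
    ∃ n, k ≤ n ∧ n ≤ K ∧ ‖1 + unitPhase (-(w * 3 ^ n / 2 ^ (n + 1)))‖ ≤ 7 / 4 := by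
  set m := max k v with hm
  refine ⟨m + 2 * (m + 1), fun w hw => ?_⟩
  by_contra! hcon
  set x : ℝ := -(w * 3 ^ m / 2 ^ (m + 1)) with hx
  have hnear : ∀ l, l ≤ 2 * (m + 1) → ∃ p : ℤ, |x * (3 / 2) ^ l - p| < 1 / 6 := by
    intro l hl
    by_contra! hfar
    refine absurd (norm_one_add_unitPhase_le hfar)
      (not_le.2 (lt_of_lt_of_eq (hcon (m + l) (by omega) (by omega)) ?_))
    rw [hx, div_pow, pow_add, show m + l + 1 = (m + 1) + l by ring, pow_add 2 (m + 1)]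
    congr 3
    field_simp
  choose! p hp using hnear
  have h1 := sub_intCast_eq_of_forall_near hp le_rfl
  have h2 := hp _ le_rfl
  rw [h1, abs_mul, abs_of_pos (by positivity : (0 : ℝ) < (3 / 2) ^ (2 * (m + 1)))] at h2
  have h3 : (2 : ℝ) ^ (m + 1) ≤ (3 / 2) ^ (2 * (m + 1)) := by
    rw [pow_mul]
    exact pow_le_pow_left₀ (by norm_num) (by norm_num) _
  have h4 : (x - p 0) * 2 ^ (m + 1) = ((-(w * 3 ^ m + p 0 * 2 ^ (m + 1)) : ℤ) : ℝ) := by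
    rw [hx]
    push_cast
    field_simp
    ring
  have h5 : -(w * 3 ^ m + p 0 * 2 ^ (m + 1)) ≠ 0 := by
    intro h0
    apply hw
    have h6 : (2 : ℤ) ^ v ∣ w * 3 ^ m := by
      refine (pow_dvd_pow 2 (show v ≤ m + 1 by omega)).trans ⟨-p 0, ?_⟩
      linarith
    exact (IsCoprime.pow (by norm_num)).dvd_of_dvd_mul_right h6
  have h7 : (1 : ℝ) ≤ |(x - p 0) * 2 ^ (m + 1)| := by
    rw [h4]
    exact_mod_cast Int.one_le_abs h5
  rw [abs_mul, abs_of_pos (by positivity : (0 : ℝ) < 2 ^ (m + 1))] at h7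
  nlinarith [abs_nonneg (x - p 0)]

/-- The sum of `exp(2πiw(3/2)^n g)` over the admissible residues `g` modulo `2 ^ n`. -/
noncomputable def admissibleSum (w : ℤ) (n : ℕ) (c : ℝ) : ℂ :=
  ∑ g ∈ Finset.range (2 ^ n), if IsAdmissible n c g then unitPhase (w * 3 ^ n / 2 ^ n * g) else 0

theorem sum_range_two_mul {α : Type*} [AddCommMonoid α] (F : ℕ → α) (n : ℕ) :
    ∑ g ∈ Finset.range (2 * n), F g =
      ∑ a ∈ Finset.range n, F (2 * a) + ∑ a ∈ Finset.range n, F (2 * a + 1) := by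
  induction n with
  | zero => simp
  | succ n ih =>
    rw [show 2 * (n + 1) = 2 * n + 1 + 1 by ring, Finset.sum_range_succ, Finset.sum_range_succ,
      ih, Finset.sum_range_succ, Finset.sum_range_succ]
    abel

theorem sum_range_two_pow_comp_affine {α : Type*} [AddCommMonoid α] (F : ℕ → α) (n b : ℕ)
    (hF : ∀ g t, F (g + 2 ^ n * t) = F g) :
    ∑ a ∈ Finset.range (2 ^ n), F (3 * a + b) = ∑ a ∈ Finset.range (2 ^ n), F a := by
  have hmod : ∀ g, F (g % 2 ^ n) = F g := fun g => by
    conv_rhs => rw [← Nat.mod_add_div g (2 ^ n), hF]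
  have hmaps : Set.MapsTo (fun a => (3 * a + b) % 2 ^ n) (Finset.range (2 ^ n))
      (Finset.range (2 ^ n)) := fun a _ => by
    simpa using Nat.mod_lt _ (by positivity)
  have hinj : Set.InjOn (fun a => (3 * a + b) % 2 ^ n) (Finset.range (2 ^ n)) := by
    intro a ha a' ha' h
    have h1 : 3 * a ≡ 3 * a' [MOD 2 ^ n] := Nat.ModEq.add_right_cancel' b h
    have h2 := Nat.ModEq.cancel_left_of_coprime
      (Nat.Coprime.pow_left n (by norm_num)) h1
    exact h2.eq_of_lt_of_lt (by simpa using ha) (by simpa using ha')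
  refine Finset.sum_nbij (fun a => (3 * a + b) % 2 ^ n) hmaps hinj
    (Finset.surjOn_of_injOn_of_card_le _ hmaps hinj le_rfl) fun a _ => (hmod _).symm

theorem sum_admissible_comp_affine (w : ℤ) (n b : ℕ) (c : ℝ) :
    ∑ a ∈ Finset.range (2 ^ n), (if IsAdmissible n c (3 * a + b) then
      unitPhase (w * 3 ^ n / 2 ^ n * (3 * a + b : ℕ)) else 0) = admissibleSum w n c := by
  refine sum_range_two_pow_comp_affine
    (fun g => if IsAdmissible n c g then unitPhase (w * 3 ^ n / 2 ^ n * g) else 0) n b ?_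
  intro g t
  simp only [isAdmissible_add_two_pow_mul]
  congr 1
  rw [← unitPhase_add_intCast (w * 3 ^ n / 2 ^ n * g) (w * 3 ^ n * t)]
  congr 1
  push_cast
  field_simp

theorem isTwistedCount_admissibleSum (w : ℤ) :
    IsTwistedCount (fun n => unitPhase (-(w * 3 ^ n / 2 ^ (n + 1)))) (admissibleSum w) := by
  have phase_even : ∀ n a : ℕ, unitPhase (w * 3 ^ (n + 1) / 2 ^ (n + 1) * (2 * a : ℕ)) =
      unitPhase (w * 3 ^ n / 2 ^ n * (3 * a + 0 : ℕ)) := by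
    intro n a
    congr 1
    push_cast
    field_simp
    ring
  have phase_odd : ∀ n a : ℕ, unitPhase (w * 3 ^ (n + 1) / 2 ^ (n + 1) * (2 * a + 1 : ℕ)) =
      unitPhase (-(w * 3 ^ n / 2 ^ (n + 1))) *
        unitPhase (w * 3 ^ n / 2 ^ n * (3 * a + 2 : ℕ)) := by
    intro n a
    rw [← unitPhase_add]
    congr 1
    push_cast
    field_simp
    ring
  refine ⟨fun n => (norm_unitPhase _).le, fun c => ?_, fun n c hc => ?_, fun n c hc => ?_⟩
  · simp [admissibleSum, IsAdmissible, norm_unitPhase]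
  · rw [← sum_admissible_comp_affine w n 0 1, ← sum_admissible_comp_affine w n 2, Finset.mul_sum,
      admissibleSum, pow_succ', sum_range_two_mul]
    congr 1
    · refine Finset.sum_congr rfl fun a _ => ?_
      rw [isAdmissible_succ_even, if_pos hc, phase_even]
      rfl
    · refine Finset.sum_congr rfl fun a _ => ?_
      simp only [isAdmissible_succ_odd, hc, true_and, phase_odd, mul_ite, mul_zero]
  · have not_odd : ∀ a, ¬ IsAdmissible (n + 1) c (2 * a + 1) := fun a h =>
      hc.not_gt ((isAdmissible_succ_odd n c a).1 h).1
    rw [← sum_admissible_comp_affine w n 0, admissibleSum, pow_succ', sum_range_two_mul]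
    simp only [not_odd, if_false, Finset.sum_const_zero, add_zero (M := ℂ)]
    refine Finset.sum_congr rfl fun a _ => ?_
    rw [isAdmissible_succ_even, if_neg hc.not_gt, phase_even]
    rfl

theorem exists_norm_admissibleSum_le (v : ℕ) {ε : ℝ} (hε : 0 < ε) :
    ∃ n₀, ∀ w : ℤ, ¬ (2 : ℤ) ^ v ∣ w → ∀ n, n₀ ≤ n → ‖admissibleSum w n 1‖ ≤ ε * (3 / 2) ^ n := by
  obtain ⟨n₀, h⟩ := IsTwistedCount.exists_norm_one_le (ι := {w : ℤ // ¬ (2 : ℤ) ^ v ∣ w})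
    (fun w => isTwistedCount_admissibleSum w) (fun k => by
      obtain ⟨K, hK⟩ := exists_norm_one_add_unitPhase_le v k
      exact ⟨K, fun w => hK w w.2⟩) hε
  exact ⟨n₀, fun w hw => h ⟨w, hw⟩⟩

/-- The admissible residues modulo `2 ^ n`. -/
noncomputable def admissibleResidues (n : ℕ) : Finset ℕ :=
  (Finset.range (2 ^ n)).filter (IsAdmissible n 1)

theorem exists_sum_unitPhase_eq (h : ℤ) (n v : ℕ) (hv : ¬ (2 : ℤ) ^ v ∣ h) :
    ∃ w : ℤ, ¬ (2 : ℤ) ^ v ∣ w ∧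
      ∑ g ∈ admissibleResidues n, unitPhase (h / 2 ^ n * g) = admissibleSum w n 1 := by
  obtain ⟨a, t, hat⟩ : IsCoprime ((2 : ℤ) ^ n) 3 := IsCoprime.pow_left (by norm_num)
  have ht : IsCoprime ((2 : ℤ) ^ v) (t ^ n) := by
    cases n with
    | zero => simpa using isCoprime_one_right
    | succ n => exact IsCoprime.pow ⟨a * 2 ^ n, 3, by rw [pow_succ] at hat; linarith⟩
  refine ⟨h * t ^ n, fun hd => hv (ht.dvd_of_dvd_mul_right hd), ?_⟩
  obtain ⟨d, hd⟩ : (2 : ℤ) ^ n ∣ h * t ^ n * 3 ^ n - h := by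
    have h1 : (2 : ℤ) ^ n ∣ (t * 3) ^ n - 1 ^ n :=
      Dvd.dvd.trans ⟨-a, by linarith⟩ (sub_dvd_pow_sub_pow (t * 3) 1 n)
    rw [mul_pow, one_pow] at h1
    have := h1.mul_left h
    rwa [mul_sub, mul_one, ← mul_assoc] at this
  rw [admissibleResidues, Finset.sum_filter, admissibleSum]
  refine Finset.sum_congr rfl fun g _ => ?_
  congr 1
  rw [← unitPhase_add_intCast _ (d * g)]
  congr 1
  have hd' : (h * t ^ n * 3 ^ n - h : ℝ) = 2 ^ n * d := by exact_mod_cast hd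
  push_cast
  field_simp
  linear_combination -g * hd'

theorem card_admissibleResidues_le (n : ℕ) :
    ((admissibleResidues n).card : ℝ) ≤ 3 * (3 / 2) ^ n := by
  have h := (isTwistedCount_admissibleSum 0).norm_le n one_pos le_rfl
  simpa [admissibleSum, unitPhase_zero, admissibleResidues, Finset.sum_boole] using h

theorem sum_sq_norm_sum_unitPhase_le (n K : ℕ) {ε : ℝ} (hε0 : 0 ≤ ε)
    (hε : ∀ h : ℤ, h ≠ 0 → |h| < K →
      ‖∑ g ∈ admissibleResidues n, unitPhase (h / 2 ^ n * g)‖ ≤ ε) :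
    ∑ g ∈ admissibleResidues n, ‖∑ l ∈ Finset.range K, unitPhase (l * (g / 2 ^ n))‖ ^ 2 ≤
      K * (3 * (3 / 2) ^ n) + K ^ 2 * ε := by
  set T : ℤ → ℂ := fun h => ∑ g ∈ admissibleResidues n, unitPhase (h / 2 ^ n * g) with hT
  have expand : ((∑ g ∈ admissibleResidues n,
      ‖∑ l ∈ Finset.range K, unitPhase (l * (g / 2 ^ n))‖ ^ 2 : ℝ) : ℂ) =
      ∑ l ∈ Finset.range K, ∑ k ∈ Finset.range K, T (l - k) := by
    simp only [hT]
    push_cast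
    simp_rw [← Complex.mul_conj', map_sum, conj_unitPhase, Finset.sum_mul_sum, ← unitPhase_add]
    rw [Finset.sum_comm]
    refine Finset.sum_congr rfl fun l _ => ?_
    rw [Finset.sum_comm]
    refine Finset.sum_congr rfl fun k _ => Finset.sum_congr rfl fun g _ => ?_
    congr 1
    ring
  have hT0 : ‖T 0‖ ≤ 3 * (3 / 2) ^ n := by
    simpa [hT, unitPhase_zero] using card_admissibleResidues_le n
  have hTle : ∀ l ∈ Finset.range K, ∀ k ∈ Finset.range K,
      ‖T (l - k)‖ ≤ (if l = k then 3 * (3 / 2) ^ n else 0) + ε := by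
    intro l hl k hk
    rw [Finset.mem_range] at hl hk
    split_ifs with h
    · rw [h, sub_self]
      linarith
    · rw [zero_add]
      exact hε _ (by omega) (by rw [abs_lt]; omega)
  have hreal : ∑ g ∈ admissibleResidues n,
      ‖∑ l ∈ Finset.range K, unitPhase (l * (g / 2 ^ n))‖ ^ 2 =
      ‖∑ l ∈ Finset.range K, ∑ k ∈ Finset.range K, T (l - k)‖ := by
    rw [← expand, Complex.norm_of_nonneg (Finset.sum_nonneg fun _ _ => sq_nonneg _)]
  rw [hreal]
  calc ‖∑ l ∈ Finset.range K, ∑ k ∈ Finset.range K, T (l - k)‖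
      ≤ ∑ l ∈ Finset.range K, ∑ k ∈ Finset.range K,
          ((if l = k then 3 * (3 / 2) ^ n else 0) + ε) :=
        norm_sum_le_of_le _ fun l hl => norm_sum_le_of_le _ fun k hk => hTle l hl k hk
    _ = ∑ l ∈ Finset.range K, (3 * (3 / 2 : ℝ) ^ n + K * ε) := by
        refine Finset.sum_congr rfl fun l hl => ?_
        rw [Finset.sum_add_distrib, Finset.sum_ite_eq, if_pos hl, Finset.sum_const,
          Finset.card_range, nsmul_eq_mul]
    _ = K * (3 * (3 / 2) ^ n) + K ^ 2 * ε := by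
        rw [Finset.sum_const, Finset.card_range, nsmul_eq_mul]
        ring

theorem half_le_norm_sum_unitPhase {K : ℕ} {y : ℝ} (h0 : 0 ≤ y) (hy : K * y ≤ 1 / 8) :
    (K : ℝ) / 2 ≤ ‖∑ l ∈ Finset.range K, unitPhase (l * y)‖ := by
  refine le_trans ?_ (Complex.re_le_norm _)
  rw [Complex.re_sum]
  have : ∀ l ∈ Finset.range K, (1 / 2 : ℝ) ≤ (unitPhase (l * y)).re := by
    intro l hl
    have hl' : (l : ℝ) ≤ K := by exact_mod_cast (Finset.mem_range.1 hl).le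
    have hly : (l : ℝ) * y ≤ 1 / 8 := (mul_le_mul_of_nonneg_right hl' h0).trans hy
    have hl0 : 0 ≤ (l : ℝ) * y := by positivity
    have hpi := Real.pi_pos
    rw [unitPhase_re, ← Real.cos_pi_div_three]
    apply Real.cos_le_cos_of_nonneg_of_le_pi <;> nlinarith
  have h := Finset.card_nsmul_le_sum _ _ _ this
  rw [Finset.card_range, nsmul_eq_mul] at h
  linarith

theorem card_filter_le_of_sum_sq {s : Finset ℕ} {f : ℕ → ℝ} {P : ℕ → Prop} [DecidablePred P]
    {a B : ℝ} (ha : 0 ≤ a) (hP : ∀ g ∈ s, P g → a ≤ f g) (hB : ∑ g ∈ s, f g ^ 2 ≤ B) :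
    ((s.filter P).card : ℝ) * a ^ 2 ≤ B := by
  refine le_trans ?_ hB
  rw [← nsmul_eq_mul]
  refine (Finset.card_nsmul_le_sum _ (fun g => f g ^ 2) _ fun g hg => ?_).trans
    (Finset.sum_le_sum_of_subset_of_nonneg (Finset.filter_subset _ _) fun g _ _ => sq_nonneg _)
  rw [Finset.mem_filter] at hg
  exact pow_le_pow_left₀ ha (hP g hg.1 hg.2) 2

/-- Admissible residues modulo `2 ^ (n + v + 3)` rarely have all of their top `v + 3` bits zero. -/
theorem exists_card_filter_lt_le (v : ℕ) {ε : ℝ} (hε : 0 < ε) :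
    ∃ n₀, ∀ n, n₀ ≤ n →
      (((admissibleResidues (n + v + 3)).filter (· < 2 ^ n)).card : ℝ) ≤
        (12 / 2 ^ v + 4 * ε) * (3 / 2) ^ (n + v + 3) := by
  obtain ⟨n₀, h₀⟩ := exists_norm_admissibleSum_le v hε
  refine ⟨n₀, fun n hn => ?_⟩
  have h1 := sum_sq_norm_sum_unitPhase_le (n + v + 3) (2 ^ v)
    (ε := ε * (3 / 2) ^ (n + v + 3)) (by positivity) (fun h hne hlt => by
      obtain ⟨w, hw, heq⟩ := exists_sum_unitPhase_eq h (n + v + 3) v fun hd =>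
        (Int.le_of_dvd (abs_pos.2 hne) ((dvd_abs _ _).2 hd)).not_gt (by exact_mod_cast hlt)
      rw [heq]
      exact h₀ w hw _ (by omega))
  have h2 := card_filter_le_of_sum_sq (P := (· < 2 ^ n)) (a := ((2 ^ v : ℕ) : ℝ) / 2)
    (by positivity) (fun g _ hg => half_le_norm_sum_unitPhase (by positivity) ?_) h1
  · have hv : (0 : ℝ) < 2 ^ v := by positivity
    push_cast at h2
    generalize (2 : ℝ) ^ v = K at h2 hv ⊢
    rw [div_add' _ _ _ hv.ne', div_mul_eq_mul_div, le_div_iff₀ hv]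
    refine le_of_mul_le_mul_right ?_ hv
    linear_combination 4 * h2
  · have hg' : (g : ℝ) ≤ 2 ^ n := by exact_mod_cast (show g < 2 ^ n from hg).le
    push_cast
    rw [mul_div_assoc', div_le_iff₀ (by positivity), pow_add, pow_add]
    have hv : (0 : ℝ) < 2 ^ v := by positivity
    nlinarith

theorem rpow_logb_two_ge {X : ℝ} {n : ℕ} (hX : 2 ^ n ≤ X) :
    (3 / 2 : ℝ) ^ n ≤ X ^ Real.logb 2 (3 / 2) := by
  have hθ : 0 ≤ Real.logb 2 (3 / 2) := Real.logb_nonneg (by norm_num) (by norm_num)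
  calc (3 / 2 : ℝ) ^ n = ((2 : ℝ) ^ Real.logb 2 (3 / 2)) ^ n := by
        rw [Real.rpow_logb (by norm_num) (by norm_num) (by norm_num)]
    _ = ((2 : ℝ) ^ n) ^ Real.logb 2 (3 / 2) := by
        rw [← Real.rpow_natCast, ← Real.rpow_natCast, ← Real.rpow_mul (by norm_num),
          ← Real.rpow_mul (by norm_num), mul_comm]
    _ ≤ X ^ Real.logb 2 (3 / 2) := Real.rpow_le_rpow (by positivity) hX hθ

/-- Flatto (1992): the number of positive integers `n ≤ X` such that `[n, n+1)` contains a
Z-number is at most `X^θ`, `θ = log₂(3/2)`, for all sufficiently large `X`. -/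
theorem flatto_Znumber_count :
    ∃ X₀ : ℝ, ∀ X : ℝ, X₀ ≤ X →
      (((Finset.Icc 1 ⌊X⌋₊).filter
          (fun n => ∃ ξ ∈ Set.Ico (n : ℝ) ((n : ℝ) + 1), IsZNumber ξ)).card : ℝ)
        ≤ X ^ (Real.logb 2 (3 / 2)) := by
  obtain ⟨n₀, h₀⟩ := exists_card_filter_lt_le 17 (ε := 1 / 50000) (by norm_num)
  refine ⟨2 ^ n₀, fun X hX => ?_⟩
  have hX1 : (1 : ℝ) ≤ X := (one_le_pow₀ (by norm_num)).trans hX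
  have hfloor : ⌊X⌋₊ ≠ 0 := (Nat.floor_pos.2 hX1).ne'
  set n := Nat.log 2 ⌊X⌋₊ with hn
  have hlo : 2 ^ n ≤ ⌊X⌋₊ := Nat.pow_log_le_self 2 hfloor
  have hhi : ⌊X⌋₊ < 2 ^ (n + 1) := Nat.lt_pow_succ_log_self one_lt_two _
  have hn₀ : n₀ ≤ n := Nat.le_log_of_pow_le one_lt_two (Nat.le_floor (by exact_mod_cast hX))
  have hXn : (2 : ℝ) ^ n ≤ X := by
    exact_mod_cast (Nat.cast_le.2 hlo).trans (Nat.floor_le (by linarith))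
  refine le_trans ?_ (rpow_logb_two_ge hXn)
  refine (Nat.cast_le.2 ((Finset.card_le_card (t := ((admissibleResidues (n + 1 + 17 + 3)).filter
    (· < 2 ^ (n + 1))).image (Nat.cast : ℕ → ℝ)) fun r hr => ?_).trans
      Finset.card_image_le)).trans ((h₀ (n + 1) (by omega)).trans ?_)
  · obtain ⟨hm, ξ, hξ, hZ⟩ := Finset.mem_filter.1 hr
    simp only [Finset.bind_def, Finset.mem_sup, Finset.pure_def, Finset.mem_singleton] at hm
    obtain ⟨m, hm, rfl⟩ := hm
    have hlt : m < 2 ^ (n + 1) := (Finset.mem_Icc.1 hm).2.trans_lt hhi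
    have hlt' : m < 2 ^ (n + 1 + 17 + 3) :=
      hlt.trans_le (Nat.pow_le_pow_right two_pos (by omega))
    refine Finset.mem_image_of_mem _ ?_
    rw [admissibleResidues, Finset.mem_filter, Finset.mem_filter, Finset.mem_range]
    exact ⟨⟨hlt', hZ.isAdmissible _ hξ.1 hξ.2 (hZ.two_mul_sub_lt_one hξ.1 hξ.2)⟩, hlt⟩
  · have hpos : (0 : ℝ) < (3 / 2) ^ n := by positivity
    rw [show n + 1 + 17 + 3 = 21 + n by ring, pow_add, ← mul_assoc]
    refine mul_le_of_le_one_left hpos.le ?_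
    norm_num
end

section
/- For every real T ≥ 1, the number N(T) of nonnegative integers m ≤ T such that 2^m can be written as a sum of distinct nonnegative integer powers of 3 satisfies N(T) ≤ 1.62·T^θ, where θ = (log 2)/(log 3). -/
open scoped Classical

/-- Only the digits below position `k + 1` matter modulo `3 ^ (k + 1)`, and the units digit of a
power of two is nonzero. -/
theorem two_pow_modEq_of_eq_sum {m : ℕ} {S : Finset ℕ} (h : 2 ^ m = ∑ i ∈ S, 3 ^ i) (k : ℕ) :
    2 ^ m ≡ 1 + ∑ i ∈ S ∩ Finset.Ioc 0 k, 3 ^ i [MOD 3 ^ (k + 1)] := by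
  have h0 : 0 ∈ S := by
    by_contra h0
    have hdvd : 3 ∣ 2 ^ m := by
      rw [h]
      refine Finset.dvd_sum fun i hi => dvd_pow_self 3 ?_
      rintro rfl
      exact h0 hi
    have := Nat.prime_three.dvd_of_dvd_pow hdvd
    omega
  have hmem : 0 ∉ S ∩ Finset.Ioc 0 k := by simp
  have hsub : insert 0 (S ∩ Finset.Ioc 0 k) ⊆ S := by
    intro i hi
    rcases Finset.mem_insert.1 hi with rfl | hi
    · exact h0
    · exact (Finset.mem_inter.1 hi).1
  have hsplit := Finset.sum_sdiff (f := fun i => 3 ^ i) hsub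
  rw [Finset.sum_insert hmem, pow_zero] at hsplit
  have hdvd : 3 ^ (k + 1) ∣ ∑ i ∈ S \ insert 0 (S ∩ Finset.Ioc 0 k), 3 ^ i := by
    refine Finset.dvd_sum fun i hi => pow_dvd_pow 3 ?_
    simp only [Finset.mem_sdiff, Finset.mem_insert, Finset.mem_inter, Finset.mem_Ioc] at hi
    grind
  rw [h, ← hsplit]
  simpa using ((Nat.modEq_zero_iff_dvd.2 hdvd).add_right (1 + ∑ i ∈ S ∩ Finset.Ioc 0 k, 3 ^ i))

theorem even_of_two_pow_modEq_one {m : ℕ} (h : 2 ^ m ≡ 1 [MOD 3]) : Even m := by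
  by_contra hm
  obtain ⟨j, rfl⟩ := Nat.not_even_iff_odd.1 hm
  have h4 : 4 ^ j ≡ 1 [MOD 3] := by simpa using (show 4 ≡ 1 [MOD 3] from rfl).pow j
  have h2 : 2 ^ (2 * j + 1) ≡ 2 [MOD 3] := by
    simpa [pow_succ, pow_mul] using h4.mul_right 2
  exact absurd (h2.symm.trans h) (by decide)

theorem three_pow_dvd_of_dvd_four_pow_sub_one {k d : ℕ} (h : 3 ^ (k + 1) ∣ 4 ^ d - 1) :
    3 ^ k ∣ d := by
  rcases Nat.eq_zero_or_pos d with rfl | hd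
  · simp
  have : Fact (Nat.Prime 3) := ⟨Nat.prime_three⟩
  have hlte := padicValNat.pow_sub_pow (p := 3) (x := 4) (y := 1) (by norm_num) (by norm_num)
    (by norm_num) (by norm_num) hd.ne'
  have hne : 4 ^ d - 1 ≠ 0 := by
    have := Nat.one_lt_pow hd.ne' (show 1 < 4 by norm_num)
    omega
  rw [padicValNat_dvd_iff_le hne] at h
  rw [padicValNat_dvd_iff_le hd.ne']
  simp only [one_pow, Nat.reduceSub, padicValNat.self (show 1 < 3 by norm_num)] at hlte
  omega

theorem eq_of_four_pow_modEq {k a b : ℕ} (ha : a < 3 ^ k) (hb : b < 3 ^ k)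
    (h : 4 ^ a ≡ 4 ^ b [MOD 3 ^ (k + 1)]) : a = b := by
  wlog hab : a ≤ b generalizing a b
  · exact (this hb ha h.symm (le_of_not_ge hab)).symm
  have hdvd := (Nat.modEq_iff_dvd' (Nat.pow_le_pow_right (by norm_num) hab)).1 h
  rw [← Nat.add_sub_of_le hab, pow_add 4, ← Nat.mul_sub_one] at hdvd
  have hcop : Nat.Coprime (3 ^ (k + 1)) (4 ^ a) := Nat.Coprime.pow _ _ (by norm_num)
  have := Nat.eq_zero_of_dvd_of_lt
    (three_pow_dvd_of_dvd_four_pow_sub_one (hcop.dvd_of_dvd_mul_left hdvd)) (by omega)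
  omega

theorem card_filter_two_pow_eq_sum_le {n k : ℕ} (hn : n ≤ 2 * 3 ^ k) :
    ((Finset.range n).filter
      (fun m => ∃ S : Finset ℕ, 2 ^ m = ∑ i ∈ S, 3 ^ i)).card ≤ 2 ^ k := by
  choose! S hS using fun m (hm : ∃ S : Finset ℕ, 2 ^ m = ∑ i ∈ S, 3 ^ i) => hm
  have hcard : (Finset.Ioc 0 k).powerset.card = 2 ^ k := by simp
  rw [← hcard]
  refine Finset.card_le_card_of_injOn (fun m => S m ∩ Finset.Ioc 0 k) ?_ ?_
  · intro m _
    simp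
  · intro a ha b hb hab
    simp only [Finset.coe_filter, Finset.mem_range, Set.mem_ofPred_eq] at ha hb
    have heven {m : ℕ} (hm : ∃ S : Finset ℕ, 2 ^ m = ∑ i ∈ S, 3 ^ i) : Even m :=
      even_of_two_pow_modEq_one (by simpa using two_pow_modEq_of_eq_sum (hS m hm) 0)
    have hmod := two_pow_modEq_of_eq_sum (hS a ha.2) k
    have hmod' := two_pow_modEq_of_eq_sum (hS b hb.2) k
    dsimp only at hab
    rw [hab] at hmod
    have h := hmod.trans hmod'.symm
    obtain ⟨a', rfl⟩ := (heven ha.2).exists_two_nsmul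
    obtain ⟨b', rfl⟩ := (heven hb.2).exists_two_nsmul
    simp only [smul_eq_mul] at *
    rw [pow_mul, pow_mul] at h
    rw [eq_of_four_pow_modEq (k := k) (by omega) (by omega) h]

theorem three_rpow_log_two_div_log_three : (3 : ℝ) ^ (Real.log 2 / Real.log 3) = 2 := by
  rw [Real.rpow_def_of_pos (by norm_num), mul_div_cancel₀ _ (Real.log_pos (by norm_num)).ne',
    Real.exp_log (by norm_num)]

theorem half_le_log_two_div_log_three : (1 / 2 : ℝ) ≤ Real.log 2 / Real.log 3 := by
  rw [div_le_div_iff₀ (by norm_num) (Real.log_pos (by norm_num))]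
  have h : Real.log 3 ≤ Real.log (2 ^ 2) := Real.log_le_log (by norm_num) (by norm_num)
  rw [Real.log_pow] at h
  push_cast at h
  linarith

/-- Narkiewicz (1980): for every real `T ≥ 1`, the number of nonnegative integers `m ≤ T` with
`2^m` a sum of distinct nonnegative integer powers of `3` is at most `1.62·T^θ`,
`θ = log 2 / log 3`. -/
theorem narkiewicz (T : ℝ) (hT : 1 ≤ T) :
    (((Finset.range (⌊T⌋₊ + 1)).filter
        (fun m => ∃ S : Finset ℕ, 2 ^ m = ∑ i ∈ S, 3 ^ i)).card : ℝ)
      ≤ 1.62 * T ^ (Real.log 2 / Real.log 3) := by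
  have hθ := half_le_log_two_div_log_three
  have h3 := three_rpow_log_two_div_log_three
  set θ := Real.log 2 / Real.log 3
  have hbound {k : ℕ} (hk : T < 2 * 3 ^ k) :
      (((Finset.range (⌊T⌋₊ + 1)).filter
        (fun m => ∃ S : Finset ℕ, 2 ^ m = ∑ i ∈ S, 3 ^ i)).card : ℝ) ≤ 2 ^ k := by
    have hfloor : ⌊T⌋₊ < 2 * 3 ^ k := (Nat.floor_lt (by linarith)).2 (by exact_mod_cast hk)
    exact_mod_cast card_filter_two_pow_eq_sum_le hfloor
  rcases lt_or_ge T 2 with hT2 | hT2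
  · have h1 : 1 ≤ T ^ θ := Real.one_le_rpow hT (by linarith)
    have := hbound (k := 0) (by simpa using hT2)
    rw [pow_zero] at this
    linarith
  · obtain ⟨n, hn, hn'⟩ := exists_nat_pow_near (show 1 ≤ T / 2 by linarith)
      (show (1 : ℝ) < 3 by norm_num)
    refine (hbound (k := n + 1) (by linarith)).trans ?_
    have hpow : ((3 : ℝ) ^ n) ^ θ = 2 ^ n := by
      rw [← Real.rpow_natCast, ← Real.rpow_mul (by norm_num), mul_comm, Real.rpow_mul (by norm_num),
        h3, Real.rpow_natCast]
    have hsqrt : (1.4 : ℝ) ≤ 2 ^ θ :=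
      calc (1.4 : ℝ) ≤ √2 := Real.le_sqrt_of_sq_le (by norm_num)
        _ = 2 ^ (1 / 2 : ℝ) := Real.sqrt_eq_rpow 2
        _ ≤ 2 ^ θ := Real.rpow_le_rpow_of_exponent_le (by norm_num) hθ
    calc (2 : ℝ) ^ (n + 1) ≤ 1.62 * (1.4 * 2 ^ n) := by
          have : (0 : ℝ) < 2 ^ n := by positivity
          rw [pow_succ]
          linarith
      _ ≤ 1.62 * (2 ^ θ * 2 ^ n) := by gcongr
      _ = 1.62 * (2 * 3 ^ n) ^ θ := by
          rw [Real.mul_rpow (by norm_num) (by positivity), hpow]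
      _ ≤ 1.62 * T ^ θ := by
          gcongr
          linarith
end

section
/- Let p ≥ 2 be an integer, let t_0, …, t_{p−1} be positive integers and u_0, …, u_{p−1} be integers with u_r ≡ r·t_r (mod p) for each r, and define T : ℤ → ℤ by T(x) = (t_r·x − u_r)/p whenever x ≡ r (mod p). Then T is a permutation (bijection) of ℤ if and only if Σ_{r=0}^{p−1} 1/t_r = 1 and T(r) ≢ T(s) (mod gcd(t_r, t_s)) for all 0 ≤ r < s ≤ p−1. -/
open Finset in
/-- A residue class modulo `m` has `L / m` representatives in `[0, L)` when `m ∣ L`. -/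
lemma card_filter_modEq_of_dvd {L m : ℤ} (hL : 0 ≤ L) (hm : 0 < m) (hmL : m ∣ L) (a : ℤ) :
    ((#{y ∈ Ico 0 L | y ≡ a [ZMOD m]} : ℕ) : ℚ) = L * (1 / m) := by
  obtain ⟨k, rfl⟩ := hmL
  have hk : 0 ≤ k := nonneg_of_mul_nonneg_right hL hm
  have hm' : (m : ℚ) ≠ 0 := by exact_mod_cast hm.ne'
  have h := Int.Ico_filter_modEq_card 0 (m * k) hm a
  have e : (((m * k : ℤ) : ℚ) - a) / m = (((0 : ℤ) : ℚ) - a) / m + (k : ℤ) := by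
    push_cast
    field_simp
    ring
  rw [e, Int.ceil_add_intCast, add_sub_cancel_left, max_eq_left hk] at h
  have h' : ((#{y ∈ Ico 0 (m * k) | y ≡ a [ZMOD m]} : ℕ) : ℚ) = (k : ℚ) := by
    exact_mod_cast h
  rw [h']
  push_cast
  field_simp

/-- Finitely many pairwise disjoint residue classes cover `ℤ` iff the reciprocals of their moduli
sum to `1`. -/
lemma forall_exists_modEq_iff_sum_one_div {ι : Type*} (s : Finset ι) (a t : ι → ℤ)
    (ht : ∀ i ∈ s, 0 < t i)
    (hd : ∀ i ∈ s, ∀ j ∈ s, i ≠ j → ∀ y, y ≡ a i [ZMOD t i] → ¬ y ≡ a j [ZMOD t j]) :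
    (∀ y : ℤ, ∃ i ∈ s, y ≡ a i [ZMOD t i]) ↔ ∑ i ∈ s, (1 : ℚ) / (t i : ℚ) = 1 := by
  classical
  set L : ℤ := ∏ i ∈ s, t i with hLdef
  have hL : 0 < L := Finset.prod_pos ht
  have hLQ : (L : ℚ) ≠ 0 := by exact_mod_cast hL.ne'
  have hdvd : ∀ i ∈ s, t i ∣ L := fun i hi => Finset.dvd_prod_of_mem t hi
  set U := s.biUnion fun i => {y ∈ Finset.Ico 0 L | y ≡ a i [ZMOD t i]} with hU
  have hsub : U ⊆ Finset.Ico 0 L :=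
    Finset.biUnion_subset.2 fun i _ => Finset.filter_subset _ _
  have hcard : (U.card : ℚ) = L * ∑ i ∈ s, (1 : ℚ) / (t i : ℚ) := by
    rw [hU, Finset.card_biUnion, Nat.cast_sum, Finset.mul_sum]
    · exact Finset.sum_congr rfl fun i hi =>
        card_filter_modEq_of_dvd hL.le (ht i hi) (hdvd i hi) _
    · intro i hi j hj hij
      refine Finset.disjoint_left.2 fun y hy hy' => ?_
      exact hd i hi j hj hij y (Finset.mem_filter.1 hy).2 (Finset.mem_filter.1 hy').2
  have hIco : ((Finset.Ico 0 L).card : ℚ) = L := by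
    have : (((Finset.Ico 0 L).card : ℕ) : ℤ) = L := by simp [hL.le]
    exact_mod_cast this
  constructor
  · intro h
    have hUeq : U = Finset.Ico 0 L := by
      refine hsub.antisymm fun y hy => ?_
      obtain ⟨i, hi, hyi⟩ := h y
      exact Finset.mem_biUnion.2 ⟨i, hi, Finset.mem_filter.2 ⟨hy, hyi⟩⟩
    rw [hUeq, hIco] at hcard
    exact mul_left_cancel₀ hLQ (by rw [← hcard, mul_one])
  · intro h y
    rw [h, mul_one, ← hIco] at hcard
    have hUeq : U = Finset.Ico 0 L :=
      Finset.eq_of_subset_of_card_le hsub (by exact_mod_cast hcard.ge)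
    have hy : y % L ∈ U := by
      rw [hUeq, Finset.mem_Ico]
      exact ⟨Int.emod_nonneg _ hL.ne', Int.emod_lt_of_pos _ hL⟩
    obtain ⟨i, hi, hyi⟩ := Finset.mem_biUnion.1 hy
    exact ⟨i, hi, ((Int.mod_modEq y L).symm.of_dvd (hdvd i hi)).trans (Finset.mem_filter.1 hyi).2⟩

/-- Two residue classes meet iff they agree modulo the gcd of the moduli. -/
lemma exists_modEq_and_modEq_iff (a b m n : ℤ) :
    (∃ y, y ≡ a [ZMOD m] ∧ y ≡ b [ZMOD n]) ↔ a ≡ b [ZMOD ((Int.gcd m n : ℕ) : ℤ)] := by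
  constructor
  · rintro ⟨y, h₁, h₂⟩
    exact (h₁.symm.of_dvd (Int.gcd_dvd_left m n)).trans (h₂.of_dvd (Int.gcd_dvd_right m n))
  · intro h
    obtain ⟨k, hk⟩ := h.dvd
    rw [Int.gcd_eq_gcd_ab] at hk
    refine ⟨a + m * (m.gcdA n * k), ?_, ?_⟩
    · exact (Int.modEq_iff_dvd.2 ⟨m.gcdA n * k, by ring⟩ : a ≡ _ [ZMOD m]).symm
    · exact Int.modEq_iff_dvd.2 ⟨m.gcdB n * k, by linear_combination hk⟩

/-- Venturini (1997): the map `T(x) = (t_r·x − u_r)/p` for `x ≡ r (mod p)` is a permutation of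
`ℤ` if and only if `Σ 1/t_r = 1` and `T(r) ≢ T(s) (mod gcd(t_r, t_s))` for `0 ≤ r < s ≤ p−1`. -/
theorem venturini_permutation (p : ℕ) (hp : 2 ≤ p) (t u : ℕ → ℤ)
    (ht : ∀ r < p, 0 < t r)
    (hu : ∀ r < p, u r ≡ (r : ℤ) * t r [ZMOD (p : ℤ)])
    (T : ℤ → ℤ)
    (hT : ∀ x : ℤ,
      (p : ℤ) * T x = t (x % (p : ℤ)).toNat * x - u (x % (p : ℤ)).toNat) :
    Function.Bijective T ↔
      ((∑ r ∈ Finset.range p, (1 : ℚ) / (t r : ℚ)) = 1 ∧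
        ∀ r < p, ∀ s < p, r < s →
          ¬ (T (r : ℤ) ≡ T (s : ℤ) [ZMOD ((Int.gcd (t r) (t s) : ℕ) : ℤ)])) := by
  have hp0 : (p : ℤ) ≠ 0 := by omega
  have hmod : ∀ r < p, ∀ k : ℤ, ((r : ℤ) + p * k) % p = r := fun r hr k => by
    rw [Int.add_mul_emod_self_left]
    exact Int.emod_eq_of_lt (by omega) (by omega)
  have hshift : ∀ r < p, ∀ k : ℤ, T (r + p * k) = T r + t r * k := fun r hr k => by
    have h₁ := hT (r + p * k)
    have h₂ := hT r
    rw [hmod r hr, Int.toNat_natCast] at h₁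
    have h₃ := hmod r hr 0
    rw [mul_zero, add_zero] at h₃
    rw [h₃, Int.toNat_natCast] at h₂
    exact mul_left_cancel₀ hp0 (by linear_combination h₁ - h₂)
  have hdecomp : ∀ x : ℤ, ∃ r < p, ∃ k : ℤ, x = r + p * k := fun x => by
    have h₀ := Int.emod_nonneg x hp0
    have h₁ := Int.emod_lt_of_pos x (show (0 : ℤ) < p by omega)
    refine ⟨(x % p).toNat, by omega, x / p, ?_⟩
    rw [Int.toNat_of_nonneg h₀, Int.emod_add_mul_ediv]
  have himage : ∀ r < p, ∀ y, y ≡ T r [ZMOD t r] ↔ ∃ k : ℤ, T (r + p * k) = y :=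
    fun r hr y => by
      rw [Int.modEq_comm, Int.modEq_iff_dvd]
      simp only [hshift r hr]
      exact exists_congr fun k => ⟨fun h => by linarith, fun h => by linarith⟩
  have hsurj : Function.Surjective T ↔
      ∀ y : ℤ, ∃ r ∈ Finset.range p, y ≡ T r [ZMOD t r] := by
    refine forall_congr' fun y => ⟨?_, ?_⟩
    · rintro ⟨x, rfl⟩
      obtain ⟨r, hr, k, rfl⟩ := hdecomp x
      exact ⟨r, Finset.mem_range.2 hr, (himage r hr _).2 ⟨k, rfl⟩⟩
    · rintro ⟨r, hr, h⟩
      obtain ⟨k, hk⟩ := (himage r (Finset.mem_range.1 hr) y).1 h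
      exact ⟨_, hk⟩
  have hinj : Function.Injective T ↔
      ∀ r ∈ Finset.range p, ∀ s ∈ Finset.range p, r ≠ s →
        ∀ y, y ≡ T r [ZMOD t r] → ¬ y ≡ T s [ZMOD t s] := by
    simp only [Finset.mem_range]
    constructor
    · intro h r hr s hs hrs y h₁ h₂
      obtain ⟨k, rfl⟩ := (himage r hr y).1 h₁
      obtain ⟨l, hl⟩ := (himage s hs _).1 h₂
      have h₃ := hmod s hs l
      rw [h hl, hmod r hr] at h₃
      exact hrs (by exact_mod_cast h₃)
    · intro h x x' hx
      obtain ⟨r, hr, k, rfl⟩ := hdecomp x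
      obtain ⟨s, hs, l, rfl⟩ := hdecomp x'
      obtain rfl | hrs := eq_or_ne r s
      · rw [hshift r hr, hshift r hr] at hx
        rw [mul_left_cancel₀ (ht r hr).ne' (add_left_cancel hx)]
      · exact (h r hr s hs hrs _ ((himage r hr _).2 ⟨k, rfl⟩)
          ((himage s hs _).2 ⟨l, hx.symm⟩)).elim
  have hgcd : (∀ r < p, ∀ s < p, r < s →
        ¬ (T (r : ℤ) ≡ T (s : ℤ) [ZMOD ((Int.gcd (t r) (t s) : ℕ) : ℤ)])) ↔
      Function.Injective T := by
    rw [hinj]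
    simp only [Finset.mem_range, ← exists_modEq_and_modEq_iff, not_exists, not_and]
    constructor
    · intro h r hr s hs hrs y h₁ h₂
      rcases lt_or_gt_of_ne hrs with hlt | hgt
      · exact h r hr s hs hlt y h₁ h₂
      · exact h s hs r hr hgt y h₂ h₁
    · exact fun h r hr s hs hrs => h r hr s hs hrs.ne
  rw [hgcd, Function.Bijective, and_comm]
  refine and_congr_left fun h => ?_
  rw [hsurj]
  exact forall_exists_modEq_iff_sum_one_div _ _ _
    (fun r hr => ht r (Finset.mem_range.1 hr)) (hinj.1 h)
end

section
/- Let a and b be positive integers with b ≥ 2, and define f : ℤ → ℤ by f(x) = a + ⌈x/b⌉. Then every trajectory of f is eventually constant or eventually reaches a cycle of period 2: for every x ∈ ℤ there exists k ≥ 0 such that f(f(f^(k)(x))) = f^(k)(x). -/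
/-- A monotone integer map that roughly halves distances has every orbit reach a fixed point. -/
theorem exists_isFixedPt_iterate_of_halving {f : ℤ → ℤ}
    (hf : ∀ y z, y ≤ z → f y ≤ f z ∧ 2 * (f z - f y) ≤ z - y + 1) (x : ℤ) :
    ∃ k : ℕ, Function.IsFixedPt f (f^[k] x) := by
  have key : ∀ (n : ℕ) (x : ℤ), |f x - x| ≤ n + 1 → ∃ k : ℕ, Function.IsFixedPt f (f^[k] x) := by
    intro n
    induction n with
    | zero =>
      intro x hx
      rw [abs_le] at hx
      refine ⟨2, ?_⟩
      change f (f (f x)) = f (f x)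
      rcases lt_trichotomy (f x) x with h | h | h
      · have h₁ := hf _ _ h.le
        have h₂ := hf _ _ h₁.1
        have h₃ := hf _ _ (h₁.1.trans h.le)
        by_cases h' : f (f x) = f x
        · rw [h', h']
        · push_cast at hx
          omega
      · rw [h, h, h]
      · have h₁ := hf _ _ h.le
        have h₂ := hf _ _ h₁.1
        have h₃ := hf _ _ (h.le.trans h₁.1)
        by_cases h' : f (f x) = f x
        · rw [h', h']
        · push_cast at hx
          omega
    | succ n ih =>
      intro x hx
      obtain ⟨k, hk⟩ := ih (f x) (by
        rw [abs_le] at hx ⊢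
        push_cast at hx
        rcases le_total (f x) x with h | h
        · have := hf _ _ h
          omega
        · have := hf _ _ h
          omega)
      exact ⟨k + 1, hk⟩
  exact key (f x - x).natAbs x (by rw [Int.natCast_natAbs]; omega)

/-- Dividing by `b ≥ 2` and rounding up is monotone and roughly halves distances. -/
theorem ceil_div_halving {b : ℕ} (hb : 2 ≤ b) {y z : ℤ} (hyz : y ≤ z) :
    ⌈(y : ℚ) / b⌉ ≤ ⌈(z : ℚ) / b⌉ ∧ 2 * (⌈(z : ℚ) / b⌉ - ⌈(y : ℚ) / b⌉) ≤ z - y + 1 := by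
  have hb0 : (0 : ℚ) < b := by exact_mod_cast (by omega : 0 < b)
  have hmono : ⌈(y : ℚ) / b⌉ ≤ ⌈(z : ℚ) / b⌉ := by gcongr
  refine ⟨hmono, ?_⟩
  have hy := Int.le_ceil ((y : ℚ) / b)
  have hz := Int.ceil_lt_add_one ((z : ℚ) / b)
  generalize ⌈(y : ℚ) / b⌉ = c at *
  generalize ⌈(z : ℚ) / b⌉ = d at *
  rw [div_le_iff₀ hb0] at hy
  rw [← sub_lt_iff_lt_add, lt_div_iff₀ hb0] at hz
  have hy' : y ≤ c * b := by exact_mod_cast hy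
  have hz' : (d - 1) * b < z := by exact_mod_cast hz
  have hb' : (2 : ℤ) ≤ b := by exact_mod_cast hb
  rcases hmono.eq_or_lt with h | h
  · omega
  · have : 0 ≤ (d - c - 1) * ((b : ℤ) - 2) := mul_nonneg (by omega) (by omega)
    linarith [show 2 * (d - c - 1) < z - y by linarith]


/-- Eisele and Hadeler (1990): for positive integers `a` and `b ≥ 2`, every trajectory of
`f(x) = a + ⌈x/b⌉` on `ℤ` becomes eventually constant or reaches a cycle of period 2:
for every `x` there is `k` with `f(f(f^(k)(x))) = f^(k)(x)`. -/
theorem eisele_hadeler (a b : ℕ) (ha : 0 < a) (hb : 2 ≤ b) :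
    ∀ x : ℤ, ∃ k : ℕ,
      (fun y : ℤ => (a : ℤ) + ⌈(y : ℚ) / (b : ℚ)⌉)^[k + 2] x =
        (fun y : ℤ => (a : ℤ) + ⌈(y : ℚ) / (b : ℚ)⌉)^[k] x := by
  intro x
  obtain ⟨k, hk⟩ := exists_isFixedPt_iterate_of_halving
    (f := fun y : ℤ => (a : ℤ) + ⌈(y : ℚ) / (b : ℚ)⌉)
    (fun y z hyz => by
      have := ceil_div_halving hb hyz
      omega) x
  refine ⟨k, ?_⟩
  rw [Function.iterate_succ_apply', Function.iterate_succ_apply', hk.eq, hk.eq]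
end
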